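/- Let n ≥ 1, Q = 2n+2, and suppose 1 < p < ∞, 1 < q' < ∞, q is the Hölder conjugate of q' (1/q + 1/q' = 1), p' is the Hölder conjugate of p, 0 < λ < Q, α + β ≥ 0, λ + α + β ≤ Q, β < 2n/p', α < 2n/q, and 1/p + 1/q' + (λ+α+β)/Q = 2. Then there exists a constant C_{Q,α,β,p,q'} > 0 such that for all f ∈ L^{q'}(ℍⁿ) and g ∈ L^{p}(ℍⁿ), ∫_{ℍⁿ}∫_{ℍⁿ} |f(u)| |g(v)| / ( |z|^{α} |u⁻¹v|^{λ} |z'|^{β} ) dv du ≤ C_{Q,α,β,p,q'} ‖f‖_{L^{q'}(ℍⁿ)} ‖g‖_{L^{p}(ℍⁿ)}, where u = (z,t), v = (z',t') and |z|, |z'| denote Euclidean norms in ℂⁿ. -/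

import Mathlib

open MeasureTheory ENNReal Filter

noncomputable section

/-- The Heisenberg group `ℍⁿ = ℂⁿ × ℝ` (as a measure space, with Lebesgue/Haar measure). -/
abbrev Hn (n : ℕ) := (Fin n → ℂ) × ℝ

/-- Euclidean norm of the `ℂⁿ` component. -/
def znorm {n : ℕ} (z : Fin n → ℂ) : ℝ := Real.sqrt (∑ j, Complex.normSq (z j))

/-- Homogeneous norm `|u| = (|z|⁴ + t²)^{1/4}` on the Heisenberg group. -/
def Hnorm {n : ℕ} (u : Hn n) : ℝ := (znorm u.1 ^ 4 + u.2 ^ 2) ^ ((1 : ℝ)/4)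

/-- Heisenberg group law `(z,t)·(z',t') = (z+z', t+t'+2 Im (z ⬝ conj z'))`. -/
def Hmul {n : ℕ} (u v : Hn n) : Hn n :=
  (u.1 + v.1, u.2 + v.2 + 2 * (∑ j, u.1 j * (starRingEnd ℂ) (v.1 j)).im)

/-- Heisenberg group inverse `(z,t)⁻¹ = (-z,-t)`. -/
def Hinv {n : ℕ} (u : Hn n) : Hn n := (-u.1, -u.2)

/-- Left-invariant quasi-distance `d(u,v) = |u⁻¹ v|`. -/
def Hdist {n : ℕ} (u v : Hn n) : ℝ := Hnorm (Hmul (Hinv u) v)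

/-- Heisenberg ball `B_ℍ(u,R)`. -/
def Hball {n : ℕ} (u : Hn n) (R : ℝ) : Set (Hn n) := {v | Hdist u v < R}

/-- Fractional integral operator `I_λ(g)(u) = ∫ g(v)/|u⁻¹v|^λ dv`. -/
def Ilam {n : ℕ} (lam : ℝ) (g : Hn n → ℝ) (u : Hn n) : ℝ :=
  ∫ v, g v / Hdist u v ^ lam

open scoped NNReal

set_option linter.unusedSectionVars false

section RadialIntegrals

variable {E : Type*} [NormedAddCommGroup E] [NormedSpace ℝ E] [FiniteDimensional ℝ E]
  [MeasurableSpace E] [BorelSpace E] (μ : Measure E) [μ.IsAddHaarMeasure]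

open Module (finrank)

lemma lintegral_eq_rpow_mul_of_homogeneous {h : ℝ≥0 → E → ℝ≥0} {s : ℝ} {ρ : ℝ≥0} (hρ : ρ ≠ 0)
    (hm : Measurable (h ρ)) (hh : ∀ z, h ρ ((ρ : ℝ) • z) = ρ ^ (-s) * h 1 z) :
    ∫⁻ z, (h ρ z : ℝ≥0∞) ∂μ
      = ((ρ ^ ((finrank ℝ E : ℝ) - s) : ℝ≥0) : ℝ≥0∞) * ∫⁻ z, (h 1 z : ℝ≥0∞) ∂μ := by
  have hρ' : (ρ : ℝ) ≠ 0 := by exact_mod_cast hρ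
  have hc : ENNReal.ofReal (abs ((ρ : ℝ) ^ finrank ℝ E)⁻¹)
      = (((ρ ^ finrank ℝ E)⁻¹ : ℝ≥0) : ℝ≥0∞) := by
    rw [abs_of_nonneg (by positivity), ENNReal.ofReal, ENNReal.coe_inj]
    ext; simp
  have h1 : ∫⁻ z, (h ρ ((ρ : ℝ) • z) : ℝ≥0∞) ∂μ
      = (((ρ ^ finrank ℝ E)⁻¹ : ℝ≥0) : ℝ≥0∞) * ∫⁻ z, (h ρ z : ℝ≥0∞) ∂μ := by
    rw [← hc, ← smul_eq_mul, ← lintegral_smul_measure, ← Measure.map_addHaar_smul μ hρ',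
      lintegral_map hm.coe_nnreal_ennreal (measurable_const_smul _)]
  have h2 : ∫⁻ z, (h ρ ((ρ : ℝ) • z) : ℝ≥0∞) ∂μ
      = ((ρ ^ (-s) : ℝ≥0) : ℝ≥0∞) * ∫⁻ z, (h 1 z : ℝ≥0∞) ∂μ := by
    simp_rw [hh, ENNReal.coe_mul]
    exact lintegral_const_mul' _ _ ENNReal.coe_ne_top
  have h3 : ∫⁻ z, (h ρ z : ℝ≥0∞) ∂μ = ((ρ ^ finrank ℝ E : ℝ≥0) : ℝ≥0∞)
      * ((((ρ ^ finrank ℝ E)⁻¹ : ℝ≥0) : ℝ≥0∞) * ∫⁻ z, (h ρ z : ℝ≥0∞) ∂μ) := by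
    rw [← mul_assoc, ← ENNReal.coe_mul, mul_inv_cancel₀ (pow_ne_zero _ hρ)]
    simp
  rw [h3, ← h1, h2, ← mul_assoc, ← ENNReal.coe_mul, sub_eq_add_neg, NNReal.rpow_add hρ,
    NNReal.rpow_natCast]

lemma exists_lintegral_nnnorm_rpow_le (hN : 1 ≤ finrank ℝ E) {b : ℝ} (hb : b < finrank ℝ E) :
    ∃ C : ℝ≥0, ∀ ρ : ℝ≥0, ρ ≠ 0 →
      ∫⁻ z, ((if ‖z‖₊ ≤ ρ then ‖z‖₊ ^ (-b) else 0 : ℝ≥0) : ℝ≥0∞) ∂μ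
        ≤ C * ((ρ ^ ((finrank ℝ E : ℝ) - b) : ℝ≥0) : ℝ≥0∞) := by
  have hm : ∀ ρ : ℝ≥0, Measurable fun z : E => if ‖z‖₊ ≤ ρ then ‖z‖₊ ^ (-b) else 0 := fun ρ =>
    Measurable.ite (measurableSet_le measurable_nnnorm measurable_const) (by fun_prop) (by fun_prop)
  have hfin : ∫⁻ z, ((if ‖z‖₊ ≤ 1 then ‖z‖₊ ^ (-b) else 0 : ℝ≥0) : ℝ≥0∞) ∂μ ≠ ∞ := by
    have hi := integrableOn_ball_of_norm_le_rpow (μ := μ) (f := fun z : E => ‖z‖ ^ (-b)) (C := 1)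
      (r := 2) hN hb (ae_of_all _ fun z => by
        rw [one_mul, Real.norm_of_nonneg (by positivity)])
      (Measurable.aestronglyMeasurable (by fun_prop))
    refine ((lintegral_mono fun z => ?_).trans_lt
      ((integrable_indicator_iff measurableSet_ball).2 hi).2).ne
    by_cases hz : ‖z‖₊ ≤ 1
    · have hz' : z ∈ Metric.ball (0 : E) 2 := by
        have : ‖z‖ ≤ 1 := hz
        simp; linarith
      rw [if_pos hz, Set.indicator_of_mem hz', enorm_eq_nnnorm, ENNReal.coe_le_coe]
      apply le_of_eq; ext
      simp [abs_of_nonneg, Real.rpow_nonneg]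
    · simp [hz]
  refine ⟨(∫⁻ z, ((if ‖z‖₊ ≤ 1 then ‖z‖₊ ^ (-b) else 0 : ℝ≥0) : ℝ≥0∞) ∂μ).toNNReal,
    fun ρ hρ => ?_⟩
  rw [ENNReal.coe_toNNReal hfin, mul_comm]
  refine (lintegral_eq_rpow_mul_of_homogeneous μ
    (h := fun ρ z => if ‖z‖₊ ≤ ρ then ‖z‖₊ ^ (-b) else 0) hρ (hm ρ) fun z => ?_).le
  have hρ' : 0 < ρ := pos_iff_ne_zero.2 hρ
  simp only [nnnorm_smul, NNReal.nnnorm_eq, mul_le_iff_le_one_right hρ', NNReal.mul_rpow]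
  split_ifs <;> simp

lemma exists_lintegral_nnnorm_add_rpow_le {s : ℝ} (hs : finrank ℝ E < s) :
    ∃ C : ℝ≥0, ∀ ρ : ℝ≥0, ρ ≠ 0 →
      ∫⁻ z, (((‖z‖₊ + ρ) ^ (-s) : ℝ≥0) : ℝ≥0∞) ∂μ
        ≤ C * ((ρ ^ ((finrank ℝ E : ℝ) - s) : ℝ≥0) : ℝ≥0∞) := by
  have hfin : ∫⁻ z, (((‖z‖₊ + 1) ^ (-s) : ℝ≥0) : ℝ≥0∞) ∂μ ≠ ∞ := by
    refine ((lintegral_mono fun z => ?_).trans_lt (finite_integral_one_add_norm (μ := μ) hs)).ne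
    rw [ENNReal.ofReal, ENNReal.coe_le_coe]
    apply le_of_eq; ext
    rw [Real.coe_toNNReal _ (by positivity)]
    simp [add_comm]
  refine ⟨(∫⁻ z, (((‖z‖₊ + 1) ^ (-s) : ℝ≥0) : ℝ≥0∞) ∂μ).toNNReal, fun ρ hρ => ?_⟩
  rw [ENNReal.coe_toNNReal hfin, mul_comm]
  refine (lintegral_eq_rpow_mul_of_homogeneous μ
    (h := fun ρ z => (‖z‖₊ + ρ) ^ (-s)) hρ (by fun_prop) fun z => ?_).le
  simp only [nnnorm_smul, NNReal.nnnorm_eq]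
  rw [← NNReal.mul_rpow]
  ring_nf

lemma exists_lintegral_nnnorm_rpow_tail_le {s : ℝ} (hs : finrank ℝ E < s) :
    ∃ C : ℝ≥0, ∀ ρ : ℝ≥0, ρ ≠ 0 →
      ∫⁻ z, ((if ρ ≤ ‖z‖₊ then ‖z‖₊ ^ (-s) else 0 : ℝ≥0) : ℝ≥0∞) ∂μ
        ≤ C * ((ρ ^ ((finrank ℝ E : ℝ) - s) : ℝ≥0) : ℝ≥0∞) := by
  obtain ⟨C, hC⟩ := exists_lintegral_nnnorm_add_rpow_le μ hs
  have hs0 : 0 < s := (Nat.cast_nonneg _).trans_lt hs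
  refine ⟨2 ^ s * C, fun ρ hρ => ?_⟩
  calc _ ≤ ∫⁻ z, ((2 ^ s : ℝ≥0) : ℝ≥0∞) * (((‖z‖₊ + ρ) ^ (-s) : ℝ≥0) : ℝ≥0∞) ∂μ := by
        refine lintegral_mono fun z => ?_
        rw [← ENNReal.coe_mul, ENNReal.coe_le_coe]
        split_ifs with h
        · have hz : 0 < ‖z‖₊ := (pos_iff_ne_zero.2 hρ).trans_le h
          rw [NNReal.rpow_neg, NNReal.rpow_neg, ← div_eq_mul_inv, ← NNReal.inv_rpow,
            ← NNReal.div_rpow]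
          gcongr
          rw [inv_le_comm₀ hz (by positivity), inv_div, div_le_iff₀ (by positivity), mul_two]
          gcongr
        · positivity
    _ = ((2 ^ s : ℝ≥0) : ℝ≥0∞) * ∫⁻ z, (((‖z‖₊ + ρ) ^ (-s) : ℝ≥0) : ℝ≥0∞) ∂μ :=
        lintegral_const_mul' _ _ ENNReal.coe_ne_top
    _ ≤ _ := by
        rw [ENNReal.coe_mul, mul_assoc]
        gcongr
        exact hC ρ hρ

lemma exists_lintegral_japanese_bracket_le {l : ℝ} (hl : 2 < l) :
    ∃ C : ℝ≥0, ∀ (c : ℝ≥0) (s : ℝ), c ≠ 0 →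
      ∫⁻ t : ℝ, ((((c ^ 4 + ‖t + s‖₊ ^ 2) ^ ((1 : ℝ) / 4)) ^ (-l) : ℝ≥0) : ℝ≥0∞)
        ≤ C * ((c ^ (2 - l) : ℝ≥0) : ℝ≥0∞) := by
  have hfr : finrank ℝ ℝ = 1 := Module.finrank_self ℝ
  obtain ⟨C, hC⟩ := exists_lintegral_nnnorm_add_rpow_le (volume : Measure ℝ) (s := l / 2)
    (by rw [hfr]; push_cast; linarith)
  refine ⟨2 ^ (l / 4) * C, fun c s hc => ?_⟩
  have hc2 : c ^ 2 ≠ 0 := pow_ne_zero _ hc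
  rw [lintegral_add_right_eq_self
    (fun t : ℝ => ((((c ^ 4 + ‖t‖₊ ^ 2) ^ ((1 : ℝ) / 4)) ^ (-l) : ℝ≥0) : ℝ≥0∞)) s]
  calc _ ≤ ∫⁻ t : ℝ, ((2 ^ (l / 4) : ℝ≥0) : ℝ≥0∞)
          * (((‖t‖₊ + c ^ 2) ^ (-(l / 2)) : ℝ≥0) : ℝ≥0∞) := by
        refine lintegral_mono fun t => ?_
        rw [← ENNReal.coe_mul, ENNReal.coe_le_coe]
        have e : (‖t‖₊ + c ^ 2) ^ (-(l / 2)) = ((‖t‖₊ + c ^ 2) ^ 2) ^ (-(l / 4)) := by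
          rw [← NNReal.rpow_natCast (_ + _), ← NNReal.rpow_mul]; congr 1; push_cast; ring
        rw [e, ← NNReal.rpow_mul, show 1 / 4 * -l = -(l / 4) by ring, NNReal.rpow_neg,
          NNReal.rpow_neg, ← div_eq_mul_inv, ← NNReal.inv_rpow, ← NNReal.div_rpow]
        have hc' : 0 < c := pos_iff_ne_zero.2 hc
        gcongr
        rw [inv_le_comm₀ (by positivity) (by positivity), inv_div, div_le_iff₀ (by positivity)]
        have := add_sq_le (a := ‖t‖₊) (b := c ^ 2)
        calc _ ≤ _ := this
          _ = _ := by ring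
    _ = ((2 ^ (l / 4) : ℝ≥0) : ℝ≥0∞) * ∫⁻ t : ℝ, (((‖t‖₊ + c ^ 2) ^ (-(l / 2)) : ℝ≥0) : ℝ≥0∞) :=
        lintegral_const_mul' _ _ ENNReal.coe_ne_top
    _ ≤ _ := by
        rw [ENNReal.coe_mul, mul_assoc]
        gcongr
        refine (hC (c ^ 2) hc2).trans (le_of_eq ?_)
        rw [hfr, ← NNReal.rpow_natCast, ← NNReal.rpow_mul]
        congr 3; push_cast; ring

end RadialIntegrals

section BilinearForms

variable {X : Type*} [MeasurableSpace X]

/-- The form `∫∫ f(u) k(u,v) g(v) dv du` is bounded on `L^{1/A} × L^{1/B}`, phrased through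
`F = |f|^{1/A}` and `G = |g|^{1/B}` of integral at most one. -/
def BoundedForm (ν : Measure X) (A B : ℝ) (k : X → X → ℝ≥0) : Prop :=
  ∃ C : ℝ≥0, ∀ F G : X → ℝ≥0, Measurable F → Measurable G →
    ∫⁻ u, F u ∂ν ≤ 1 → ∫⁻ v, G v ∂ν ≤ 1 →
      ∫⁻ u, ∫⁻ v, ((F u ^ A * G v ^ B * k u v : ℝ≥0) : ℝ≥0∞) ∂ν ∂ν ≤ C

variable {ν : Measure X} {A B : ℝ} {k : X → X → ℝ≥0}

lemma lintegral_lintegral_add_left [SFinite ν] {f g : X → X → ℝ≥0∞}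
    (hf : Measurable (Function.uncurry f)) :
    ∫⁻ u, ∫⁻ v, (f u v + g u v) ∂ν ∂ν = ∫⁻ u, ∫⁻ v, f u v ∂ν ∂ν + ∫⁻ u, ∫⁻ v, g u v ∂ν ∂ν :=
  (lintegral_congr fun _ => lintegral_add_left (hf.comp measurable_prodMk_left) _).trans
    (lintegral_add_left hf.lintegral_prod_right' _)

lemma BoundedForm.swap [SFinite ν] (h : BoundedForm ν A B k)
    (hk : Measurable (Function.uncurry k)) : BoundedForm ν B A (fun u v => k v u) := by
  obtain ⟨C, hC⟩ := h
  refine ⟨C, fun F G hF hG hF1 hG1 => ?_⟩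
  rw [lintegral_lintegral_swap]
  · refine le_of_eq_of_le ?_ (hC G F hG hF hG1 hF1)
    simp_rw [mul_comm (G _ ^ A)]
  · have hk' : Measurable fun p : X × X => k p.2 p.1 := hk.comp measurable_swap
    apply Measurable.aemeasurable
    exact (((((hF.comp measurable_fst).pow_const B).mul
      ((hG.comp measurable_snd).pow_const A)).mul hk')).coe_nnreal_ennreal

lemma BoundedForm.add [SFinite ν] {k' : X → X → ℝ≥0} (h : BoundedForm ν A B k)
    (h' : BoundedForm ν A B k') (hk : Measurable (Function.uncurry k)) :
    BoundedForm ν A B (fun u v => k u v + k' u v) := by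
  obtain ⟨C, hC⟩ := h
  obtain ⟨C', hC'⟩ := h'
  refine ⟨C + C', fun F G hF hG hF1 hG1 => ?_⟩
  have hm : Measurable fun p : X × X =>
      ((F p.1 ^ A * G p.2 ^ B * k p.1 p.2 : ℝ≥0) : ℝ≥0∞) :=
    (((((hF.comp measurable_fst).pow_const A).mul
      ((hG.comp measurable_snd).pow_const B)).mul hk)).coe_nnreal_ennreal
  rw [ENNReal.coe_add]
  refine le_of_eq_of_le ?_ (add_le_add (hC F G hF hG hF1 hG1) (hC' F G hF hG hF1 hG1))
  rw [← lintegral_lintegral_add_left hm]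
  simp [mul_add]

lemma BoundedForm.mono {k' : X → X → ℝ≥0} (c : ℝ≥0) (h : BoundedForm ν A B k')
    (hk : ∀ u v, k u v ≤ c * k' u v) : BoundedForm ν A B k := by
  obtain ⟨C, hC⟩ := h
  refine ⟨c * C, fun F G hF hG hF1 hG1 => ?_⟩
  rw [ENNReal.coe_mul]
  grw [← hC F G hF hG hF1 hG1]
  simp_rw [← lintegral_const_mul' (c : ℝ≥0∞) _ ENNReal.coe_ne_top, ← ENNReal.coe_mul]
  refine lintegral_mono fun u => lintegral_mono fun v => ENNReal.coe_le_coe.2 ?_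
  grw [hk u v]
  exact le_of_eq (by ring)

lemma boundedForm_of_majorants [SFinite ν] (C₁ C₂ : ℝ≥0)
    (h : ∀ F G : X → ℝ≥0, Measurable F → Measurable G → ∃ M₁ M₂ : X → X → ℝ≥0,
      Measurable (Function.uncurry M₁) ∧ Measurable (Function.uncurry M₂) ∧
      (∀ u v, F u ^ A * G v ^ B * k u v ≤ F u * G v + F u * M₁ u v + G v * M₂ u v) ∧
      (∀ u, ∫⁻ v, M₁ u v ∂ν ≤ C₁) ∧ (∀ v, ∫⁻ u, M₂ u v ∂ν ≤ C₂)) :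
    BoundedForm ν A B k := by
  refine ⟨1 + C₁ + C₂, fun F G hF hG hF1 hG1 => ?_⟩
  obtain ⟨M₁, M₂, hM₁, hM₂, hle, h1, h2⟩ := h F G hF hG
  have hF' := hF.coe_nnreal_ennreal
  have hG' := hG.coe_nnreal_ennreal
  have m1 : Measurable fun p : X × X => (F p.1 : ℝ≥0∞) * G p.2 :=
    (hF'.comp measurable_fst).mul (hG'.comp measurable_snd)
  have m2 : Measurable fun p : X × X => (F p.1 : ℝ≥0∞) * M₁ p.1 p.2 :=
    (hF'.comp measurable_fst).mul hM₁.coe_nnreal_ennreal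
  have m3 : Measurable fun p : X × X => (G p.2 : ℝ≥0∞) * M₂ p.1 p.2 :=
    (hG'.comp measurable_snd).mul hM₂.coe_nnreal_ennreal
  have e1 : ∫⁻ u, ∫⁻ v, (F u : ℝ≥0∞) * G v ∂ν ∂ν ≤ 1 := by
    simp_rw [lintegral_const_mul' _ _ ENNReal.coe_ne_top]
    rw [lintegral_mul_const _ hF']
    exact mul_le_one' hF1 hG1
  have e2 : ∫⁻ u, ∫⁻ v, (F u : ℝ≥0∞) * M₁ u v ∂ν ∂ν ≤ C₁ := by
    simp_rw [lintegral_const_mul' _ _ ENNReal.coe_ne_top]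
    calc _ ≤ ∫⁻ u, (F u : ℝ≥0∞) * C₁ ∂ν := by
          gcongr with u
          exact h1 u
      _ ≤ _ := by
          rw [lintegral_mul_const _ hF']
          exact mul_le_of_le_one_left' hF1
  have e3 : ∫⁻ u, ∫⁻ v, (G v : ℝ≥0∞) * M₂ u v ∂ν ∂ν ≤ C₂ := by
    rw [lintegral_lintegral_swap m3.aemeasurable]
    simp_rw [lintegral_const_mul' _ _ ENNReal.coe_ne_top]
    calc _ ≤ ∫⁻ u, (G u : ℝ≥0∞) * C₂ ∂ν := by
          gcongr with u
          exact h2 u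
      _ ≤ _ := by
          rw [lintegral_mul_const _ hG']
          exact mul_le_of_le_one_left' hG1
  calc _ ≤ ∫⁻ u, ∫⁻ v, ((F u : ℝ≥0∞) * G v + F u * M₁ u v + G v * M₂ u v) ∂ν ∂ν := by
        gcongr with u v
        exact_mod_cast hle u v
    _ = ∫⁻ u, ∫⁻ v, (F u : ℝ≥0∞) * G v ∂ν ∂ν + ∫⁻ u, ∫⁻ v, (F u : ℝ≥0∞) * M₁ u v ∂ν ∂ν
        + ∫⁻ u, ∫⁻ v, (G v : ℝ≥0∞) * M₂ u v ∂ν ∂ν := by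
        rw [lintegral_lintegral_add_left (m1.add m2), lintegral_lintegral_add_left m1]
    _ ≤ _ := by
        push_cast
        gcongr

lemma boundedForm_of_schur_young [SFinite ν] (hA : A ≤ 1) (hB : B ≤ 1) (hAB : 1 ≤ A + B)
    (hA0 : 0 < A) (hB0 : 0 < B) {k₁ k₂ : X → X → ℝ≥0}
    (hm₁ : Measurable (Function.uncurry k₁)) (hm₂ : Measurable (Function.uncurry k₂))
    (hk : ∀ u v, k u v ≤ k₁ u v ^ (1 - B) * k₂ u v ^ (1 - A))
    {C₁ C₂ : ℝ≥0} (h₁ : ∀ u, ∫⁻ v, k₁ u v ∂ν ≤ C₁) (h₂ : ∀ v, ∫⁻ u, k₂ u v ∂ν ≤ C₂) :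
    BoundedForm ν A B k := by
  refine boundedForm_of_majorants C₁ C₂ fun F G _ _ => ⟨k₁, k₂, hm₁, hm₂, fun u v => ?_, h₁, h₂⟩
  lift 1 - B to ℝ≥0 using by linarith with b hb
  lift 1 - A to ℝ≥0 using by linarith with a ha
  obtain ⟨r, hr⟩ : ∃ r : ℝ≥0, (r : ℝ) = A + B - 1 := ⟨⟨A + B - 1, by linarith⟩, rfl⟩
  have hsum : r + b + a = 1 := by
    ext; push_cast; rw [hr, hb, ha]; ring
  have hr1 : r ≤ 1 := hsum ▸ (by rw [add_assoc]; exact le_self_add)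
  have hb1 : b ≤ 1 := hsum ▸ (by rw [add_comm r b, add_assoc]; exact le_self_add)
  have ha1 : a ≤ 1 := hsum ▸ le_add_self
  have hpow : ∀ x : ℝ≥0, ∀ c : ℝ≥0, ∀ s : ℝ, s = r + c → s ≠ 0 →
      x ^ s = x ^ (r : ℝ) * x ^ (c : ℝ) := fun x c s hs hs0 => by
    subst hs; exact NNReal.rpow_add' hs0 x
  calc _ ≤ F u ^ A * G v ^ B * (k₁ u v ^ (b : ℝ) * k₂ u v ^ (a : ℝ)) := by
        gcongr; exact hk u v
    _ = (F u * G v) ^ (r : ℝ) * (F u * k₁ u v) ^ (b : ℝ) * (G v * k₂ u v) ^ (a : ℝ) := by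
        rw [hpow (F u) b A (by rw [hr, hb]; ring) hA0.ne',
          hpow (G v) a B (by rw [hr, ha]; ring) hB0.ne']
        simp only [NNReal.mul_rpow]
        ring
    _ ≤ r * (F u * G v) + b * (F u * k₁ u v) + a * (G v * k₂ u v) :=
        NNReal.geom_mean_le_arith_mean3_weighted _ _ _ _ _ _ hsum
    _ ≤ _ := by
        exact add_le_add (add_le_add (mul_le_of_le_one_left' hr1) (mul_le_of_le_one_left' hb1))
          (mul_le_of_le_one_left' ha1)

/-- The majorant `κ · min ((κ/φ)^ε, (φ/κ)^ε)`. -/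
def hlsMajorant (ε : ℝ) (φ κ : ℝ≥0) : ℝ≥0 :=
  if κ ≤ φ then κ ^ (1 + ε) * φ ^ (-ε) else κ ^ (1 - ε) * φ ^ ε

lemma rpow_mul_rpow_le {x y a b c : ℝ} {f k : ℝ≥0} (hk : k ≠ 0) (hkf : k ≤ f)
    (hx : x = a + c) (hy : y = b - c) (hc : 0 ≤ c) : f ^ a * k ^ b ≤ f ^ x * k ^ y := by
  have hf : f ≠ 0 := fun h => hk (nonpos_iff_eq_zero.1 (h ▸ hkf))
  subst hx hy
  rw [NNReal.rpow_add hf, NNReal.rpow_sub hk, mul_assoc, mul_div_left_comm]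
  gcongr
  refine le_mul_of_one_le_right' ?_
  rw [one_le_div (NNReal.rpow_pos (pos_iff_ne_zero.2 hk))]
  gcongr

lemma rpow_mul_rpow_mul_rpow_le {A B ε : ℝ} (hA0 : 0 < A) (hB0 : 0 < B) (hA : A ≤ 1 - ε)
    (hB : B ≤ 1 - ε) (hε : 0 ≤ ε)
    (hAB : 1 + ε ≤ A + B) (f g k : ℝ≥0) (hk : k ≠ 0) :
    f ^ A * g ^ B * k ^ (2 - A - B) ≤ f * g + f * hlsMajorant ε f k + g * hlsMajorant ε g k := by
  rcases eq_or_ne f 0 with rfl | hf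
  · simp [hA0.ne']
  rcases eq_or_ne g 0 with rfl | hg
  · simp [hB0.ne']
  have hsplit : ∀ x y : ℝ, k ^ (x + y) = k ^ x * k ^ y := fun x y => NNReal.rpow_add hk x y
  have hone : ∀ {x : ℝ≥0}, x ≠ 0 → ∀ s : ℝ, x * x ^ s = x ^ (1 + s) := fun hx s => by
    rw [NNReal.rpow_add hx, NNReal.rpow_one]
  unfold hlsMajorant
  by_cases h1 : k ≤ f <;> by_cases h2 : k ≤ g
  · refine le_trans ?_ (le_add_right le_self_add)
    rw [show 2 - A - B = (1 - A) + (1 - B) by ring, hsplit]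
    calc _ = (f ^ A * k ^ (1 - A)) * (g ^ B * k ^ (1 - B)) := by ring
      _ ≤ (f ^ (1 : ℝ) * k ^ (0 : ℝ)) * (g ^ (1 : ℝ) * k ^ (0 : ℝ)) := by
          gcongr ?_ * ?_
          · exact rpow_mul_rpow_le (c := 1 - A) hk h1 (by ring) (by ring) (by linarith)
          · exact rpow_mul_rpow_le (c := 1 - B) hk h2 (by ring) (by ring) (by linarith)
      _ = _ := by simp
  · refine le_trans ?_ (le_add_right le_add_self)
    rw [if_pos h1]
    calc _ ≤ f ^ A * k ^ B * k ^ (2 - A - B) := by gcongr; exact (not_le.1 h2).le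
      _ = f ^ A * k ^ (2 - A) := by rw [mul_assoc, ← hsplit]; ring_nf
      _ ≤ f ^ (1 - ε) * k ^ (1 + ε) :=
          rpow_mul_rpow_le (c := 1 - ε - A) hk h1 (by ring) (by ring) (by linarith)
      _ = _ := by rw [mul_left_comm, hone hf, mul_comm]; rfl
  · refine le_trans ?_ le_add_self
    rw [if_pos h2]
    calc _ ≤ k ^ A * g ^ B * k ^ (2 - A - B) := by gcongr; exact (not_le.1 h1).le
      _ = g ^ B * k ^ (2 - B) := by
          rw [show 2 - B = A + (2 - A - B) by ring, hsplit]; ring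
      _ ≤ g ^ (1 - ε) * k ^ (1 + ε) :=
          rpow_mul_rpow_le (c := 1 - ε - B) hk h2 (by ring) (by ring) (by linarith)
      _ = _ := by rw [mul_left_comm, hone hg, mul_comm]; rfl
  · rw [if_neg h1, if_neg h2]
    have key : ∀ x : ℝ≥0, x ≠ 0 → x ≤ k →
        x ^ (A + B) * k ^ (2 - A - B) ≤ x * (k ^ (1 - ε) * x ^ ε) := fun x hx hxk => by
      rw [mul_left_comm, hone hx, mul_comm (x ^ _)]
      exact rpow_mul_rpow_le (c := A + B - 1 - ε) hx hxk (by ring) (by ring) (by linarith)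
    rcases le_total f g with h | h
    · refine le_trans ?_ le_add_self
      refine le_trans ?_ (key g hg (not_le.1 h2).le)
      rw [NNReal.rpow_add hg]
      gcongr
    · refine le_trans ?_ (le_add_right le_add_self)
      refine le_trans ?_ (key f hf (not_le.1 h1).le)
      rw [NNReal.rpow_add hf]
      gcongr

end BilinearForms

section TwistedDistance

variable {E : Type*} [NormedAddCommGroup E] [NormedSpace ℝ E] [FiniteDimensional ℝ E]
  [MeasurableSpace E] [BorelSpace E] (μ : Measure E) [μ.IsAddHaarMeasure]

open Module (finrank)
open scoped Classical

lemma rpow_le_rpow_mul_rpow {a b c : ℝ≥0} {s : ℝ} (hs : s ≤ 0) (ha : a ≠ 0) (h : a ≤ c * b) :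
    b ^ s ≤ c ^ (-s) * a ^ s := by
  obtain ⟨r, rfl⟩ : ∃ r, s = -r := ⟨-s, by ring⟩
  have ha' : 0 < a := pos_iff_ne_zero.2 ha
  have hcb : 0 < c * b := ha'.trans_le h
  have hb : 0 < b := pos_of_mul_pos_right hcb (by positivity)
  rw [neg_neg, NNReal.rpow_neg, NNReal.rpow_neg, ← div_eq_mul_inv, ← NNReal.inv_rpow,
    ← NNReal.div_rpow]
  gcongr
  · linarith
  · rwa [inv_le_comm₀ hb (by
      have : 0 < c := pos_of_mul_pos_left hcb (by positivity)
      positivity), inv_div, div_le_iff₀' (pos_of_mul_pos_left hcb (by positivity))]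

lemma exists_lintegral_fibre_le {l : ℝ} (hl : 2 < l) :
    ∃ C : ℝ≥0, ∀ (s : E → ℝ) (c φ : E → ℝ≥0), Measurable s → Measurable c → Measurable φ →
      (∀ z, c z = 0 → φ z = 0) →
      ∫⁻ v : E × ℝ, ((φ v.1 * ((c v.1 ^ 4 + ‖v.2 + s v.1‖₊ ^ 2) ^ ((1 : ℝ) / 4)) ^ (-l) : ℝ≥0) :
          ℝ≥0∞) ∂(μ.prod volume)
        ≤ C * ∫⁻ z, ((φ z * c z ^ (2 - l) : ℝ≥0) : ℝ≥0∞) ∂μ := by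
  obtain ⟨C, hC⟩ := exists_lintegral_japanese_bracket_le hl
  refine ⟨C, fun s c φ hs hc hφ h0 => ?_⟩
  rw [lintegral_prod _ (Measurable.aemeasurable (by fun_prop)),
    ← lintegral_const_mul' _ _ ENNReal.coe_ne_top]
  refine lintegral_mono fun z => ?_
  simp_rw [ENNReal.coe_mul]
  rw [lintegral_const_mul' _ _ ENNReal.coe_ne_top, mul_left_comm]
  by_cases hz : c z = 0
  · simp [h0 z hz]
  · gcongr
    exact hC (c z) (s z) hz

/-- The norm part of the distance on `E × ℝ` twisted by `ω`. -/
def twistedDist (ω : E → E → ℝ) (u v : E × ℝ) : ℝ≥0 :=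
  (‖v.1 - u.1‖₊ ^ 4 + ‖v.2 - u.2 + ω u.1 v.1‖₊ ^ 2) ^ ((1 : ℝ) / 4)

lemma twistedDist_swap (ω : E → E → ℝ) (u v : E × ℝ) :
    twistedDist ω u v = twistedDist (fun a b => -ω b a) v u := by
  unfold twistedDist
  rw [← nnnorm_neg (v.1 - u.1), ← nnnorm_neg (v.2 - u.2 + ω u.1 v.1), neg_sub,
    show -(v.2 - u.2 + ω u.1 v.1) = u.2 - v.2 + -ω u.1 v.1 by ring]

lemma nnnorm_sub_le_twistedDist (ω : E → E → ℝ) (u v : E × ℝ) :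
    ‖v.1 - u.1‖₊ ≤ twistedDist ω u v := by
  unfold twistedDist
  rw [one_div, NNReal.le_rpow_inv_iff (by norm_num)]
  norm_cast
  exact le_self_add

variable {ω : E → E → ℝ}

lemma measurable_twistedDist (hω : Measurable (Function.uncurry ω)) :
    Measurable fun p : (E × ℝ) × (E × ℝ) => twistedDist ω p.1 p.2 := by
  unfold twistedDist
  have : Measurable fun p : (E × ℝ) × (E × ℝ) => ω p.1.1 p.2.1 :=
    hω.comp (measurable_fst.fst.prodMk measurable_snd.fst)
  fun_prop

lemma exists_lintegral_twistedDist_le {l : ℝ} (hl : 2 < l) :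
    ∃ C : ℝ≥0, ∀ (ω : E → E → ℝ), Measurable (Function.uncurry ω) → ∀ (u : E × ℝ) (φ : E → ℝ≥0),
      Measurable φ → φ u.1 = 0 →
      ∫⁻ v : E × ℝ, ((φ v.1 * twistedDist ω u v ^ (-l) : ℝ≥0) : ℝ≥0∞) ∂(μ.prod volume)
        ≤ C * ∫⁻ z, ((φ z * ‖z - u.1‖₊ ^ (2 - l) : ℝ≥0) : ℝ≥0∞) ∂μ := by
  obtain ⟨C, hC⟩ := exists_lintegral_fibre_le μ hl
  refine ⟨C, fun ω hω u φ hφ h0 => ?_⟩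
  have hm : Measurable fun z => ω u.1 z := hω.comp measurable_prodMk_left
  refine le_of_eq_of_le ?_ (hC (fun z => -u.2 + ω u.1 z) (fun z => ‖z - u.1‖₊) φ
    (by fun_prop) (by fun_prop) hφ fun z hz => ?_)
  · simp only [twistedDist, sub_eq_add_neg, add_assoc]
  · rwa [sub_eq_zero.1 (nnnorm_eq_zero.1 hz)]

/-- Interior part of the kernel: the second variable is much closer to the vertical axis. -/
lemma exists_lintegral_near_axis_le (hN : 1 ≤ finrank ℝ E) {l a b : ℝ} (hl : 2 < l)
    (hb : b < finrank ℝ E) (hab : a + b + l = finrank ℝ E + 2) :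
    ∃ C : ℝ≥0, ∀ (ω : E → E → ℝ), Measurable (Function.uncurry ω) → ∀ u : E × ℝ,
      ∫⁻ v : E × ℝ, (((if v.1 ≠ 0 ∧ 2 * ‖v.1‖₊ < ‖u.1‖₊ then ‖u.1‖₊ ^ (-a) * ‖v.1‖₊ ^ (-b) else 0)
        * twistedDist ω u v ^ (-l) : ℝ≥0) : ℝ≥0∞) ∂(μ.prod volume) ≤ C := by
  obtain ⟨C, hC⟩ := exists_lintegral_twistedDist_le μ hl
  obtain ⟨C', hC'⟩ := exists_lintegral_nnnorm_rpow_le μ hN hb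
  refine ⟨C * (2 ^ (l - 2) * C'), fun ω hω u => ?_⟩
  have hset : MeasurableSet {z : E | z ≠ 0 ∧ 2 * ‖z‖₊ < ‖u.1‖₊} :=
    (measurableSet_singleton (0 : E)).compl.inter
      (measurableSet_lt (by fun_prop) measurable_const)
  refine (hC ω hω u (fun z => if z ≠ 0 ∧ 2 * ‖z‖₊ < ‖u.1‖₊ then ‖u.1‖₊ ^ (-a) * ‖z‖₊ ^ (-b) else 0)
    (Measurable.ite hset (by fun_prop) (by fun_prop)) (if_neg ?_)).trans ?_
  · rintro ⟨-, h⟩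
    rw [two_mul] at h
    exact absurd (lt_of_le_of_lt le_self_add h) (lt_irrefl _)
  rcases eq_or_ne ‖u.1‖₊ 0 with hx | hx
  · simp [hx]
  rw [ENNReal.coe_mul]
  gcongr
  calc _ ≤ ∫⁻ z, ((2 ^ (l - 2) * ‖u.1‖₊ ^ (2 - l - a) : ℝ≥0) : ℝ≥0∞) *
        ((if ‖z‖₊ ≤ ‖u.1‖₊ then ‖z‖₊ ^ (-b) else 0 : ℝ≥0) : ℝ≥0∞) ∂μ := by
        refine lintegral_mono fun z => ?_
        rw [← ENNReal.coe_mul, ENNReal.coe_le_coe]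
        split_ifs with h h' h'
        · have hw : ‖u.1‖₊ ≤ 2 * ‖z - u.1‖₊ := by
            have h1 : ‖u.1‖ ≤ ‖z‖ + ‖z - u.1‖ := by
              rw [← norm_sub_rev u.1 z]; simpa using norm_add_le z (u.1 - z)
            have h2 : 2 * ‖z‖ < ‖u.1‖ := h.2
            have : ‖u.1‖ ≤ 2 * ‖z - u.1‖ := by linarith
            exact this
          grw [rpow_le_rpow_mul_rpow (s := 2 - l) (by linarith) hx hw]
          rw [sub_eq_add_neg (2 - l), NNReal.rpow_add hx, neg_sub]
          exact le_of_eq (by ring)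
        · refine absurd ?_ h'
          refine le_trans ?_ h.2.le
          rw [two_mul]; exact le_self_add
        · simp
        · simp
    _ ≤ ((2 ^ (l - 2) * ‖u.1‖₊ ^ (2 - l - a) : ℝ≥0) : ℝ≥0∞) *
        (C' * ((‖u.1‖₊ ^ ((finrank ℝ E : ℝ) - b) : ℝ≥0) : ℝ≥0∞)) := by
        rw [lintegral_const_mul' _ _ ENNReal.coe_ne_top]
        gcongr
        exact hC' _ hx
    _ = _ := by
        rw [← ENNReal.coe_mul, ← ENNReal.coe_mul, mul_mul_mul_comm, mul_comm (‖u.1‖₊ ^ _) (_ ^ _),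
          ← mul_assoc]
        rw [mul_assoc (_ * _), ← NNReal.rpow_add hx]
        rw [show (finrank ℝ E : ℝ) - b + (2 - l - a) = 0 by linarith]
        simp

/-- Exterior part of the kernel: the second variable is much further from the vertical axis. -/
lemma exists_lintegral_far_axis_le {l a b : ℝ} (hl : 2 < l)
    (hb : b < 0) (hab : a + b + l = finrank ℝ E + 2) :
    ∃ C : ℝ≥0, ∀ (ω : E → E → ℝ), Measurable (Function.uncurry ω) → ∀ u : E × ℝ,
      ∫⁻ v : E × ℝ, (((if u.1 ≠ 0 ∧ 2 * ‖u.1‖₊ < ‖v.1‖₊ then ‖v.1‖₊ ^ (-a) * ‖u.1‖₊ ^ (-b) else 0)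
        * twistedDist ω u v ^ (-l) : ℝ≥0) : ℝ≥0∞) ∂(μ.prod volume) ≤ C := by
  obtain ⟨C, hC⟩ := exists_lintegral_twistedDist_le μ hl
  obtain ⟨C', hC'⟩ := exists_lintegral_nnnorm_rpow_tail_le μ (s := a + l - 2) (by linarith)
  refine ⟨C * (2 ^ (l - 2) * C'), fun ω hω u => ?_⟩
  have hset : MeasurableSet {z : E | u.1 ≠ 0 ∧ 2 * ‖u.1‖₊ < ‖z‖₊} :=
    (MeasurableSet.const _).inter (measurableSet_lt measurable_const (by fun_prop))
  refine (hC ω hω u (fun z => if u.1 ≠ 0 ∧ 2 * ‖u.1‖₊ < ‖z‖₊ then ‖z‖₊ ^ (-a) * ‖u.1‖₊ ^ (-b) else 0)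
    (Measurable.ite hset (by fun_prop) (by fun_prop)) (if_neg ?_)).trans ?_
  · rintro ⟨-, h⟩
    rw [two_mul] at h
    exact absurd (lt_of_le_of_lt le_self_add h) (lt_irrefl _)
  rcases eq_or_ne u.1 0 with hx0 | hx0
  · simp [hx0]
  have hx : ‖u.1‖₊ ≠ 0 := nnnorm_ne_zero_iff.2 hx0
  rw [ENNReal.coe_mul]
  gcongr
  calc _ ≤ ∫⁻ z, ((2 ^ (l - 2) * ‖u.1‖₊ ^ (-b) : ℝ≥0) : ℝ≥0∞) *
        ((if ‖u.1‖₊ ≤ ‖z‖₊ then ‖z‖₊ ^ (-(a + l - 2)) else 0 : ℝ≥0) : ℝ≥0∞) ∂μ := by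
        refine lintegral_mono fun z => ?_
        rw [← ENNReal.coe_mul, ENNReal.coe_le_coe]
        split_ifs with h h' h'
        · have hw : ‖z‖₊ ≤ 2 * ‖z - u.1‖₊ := by
            have h1 : ‖z‖ ≤ ‖u.1‖ + ‖z - u.1‖ := by
              simpa using norm_add_le u.1 (z - u.1)
            have h2 : 2 * ‖u.1‖ < ‖z‖ := h.2
            have : ‖z‖ ≤ 2 * ‖z - u.1‖ := by linarith
            exact this
          have hz : ‖z‖₊ ≠ 0 := (pos_of_gt h.2).ne'
          grw [rpow_le_rpow_mul_rpow (s := 2 - l) (by linarith) hz hw]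
          rw [show -(a + l - 2) = -a + (2 - l) by ring, NNReal.rpow_add hz, neg_sub]
          exact le_of_eq (by ring)
        · refine absurd ?_ h'
          refine le_trans ?_ h.2.le
          rw [two_mul]; exact le_self_add
        · simp
        · simp
    _ ≤ ((2 ^ (l - 2) * ‖u.1‖₊ ^ (-b) : ℝ≥0) : ℝ≥0∞) *
        (C' * ((‖u.1‖₊ ^ ((finrank ℝ E : ℝ) - (a + l - 2)) : ℝ≥0) : ℝ≥0∞)) := by
        rw [lintegral_const_mul' _ _ ENNReal.coe_ne_top]
        gcongr
        exact hC' _ hx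
    _ = _ := by
        rw [← ENNReal.coe_mul, ← ENNReal.coe_mul, mul_mul_mul_comm, ← NNReal.rpow_add hx,
          show -b + ((finrank ℝ E : ℝ) - (a + l - 2)) = 0 by linarith]
        simp

/-- Diagonal part of the kernel: both variables are comparably far from the vertical axis. -/
lemma exists_lintegral_diagonal_le (hN : 1 ≤ finrank ℝ E) {l c : ℝ} (hl : 2 < l)
    (hlN : l < finrank ℝ E + 2) (hlc : l + c = finrank ℝ E + 2) :
    ∃ C : ℝ≥0, ∀ (ω : E → E → ℝ), Measurable (Function.uncurry ω) → ∀ u : E × ℝ,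
      ∫⁻ v : E × ℝ, (((if u.1 ≠ v.1 ∧ u.1 ≠ 0 ∧ ‖v.1‖₊ ≤ 2 * ‖u.1‖₊ then ‖u.1‖₊ ^ (-c) else 0)
        * twistedDist ω u v ^ (-l) : ℝ≥0) : ℝ≥0∞) ∂(μ.prod volume) ≤ C := by
  obtain ⟨C, hC⟩ := exists_lintegral_twistedDist_le μ hl
  obtain ⟨C', hC'⟩ := exists_lintegral_nnnorm_rpow_le μ hN (b := l - 2) (by linarith)
  refine ⟨C * (3 ^ c * C'), fun ω hω u => ?_⟩
  have hset : MeasurableSet {z : E | u.1 ≠ z ∧ u.1 ≠ 0 ∧ ‖z‖₊ ≤ 2 * ‖u.1‖₊} :=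
    (measurableSet_eq_fun measurable_const measurable_id).compl.inter
      ((MeasurableSet.const _).inter (measurableSet_le (by fun_prop) measurable_const))
  refine (hC ω hω u (fun z => if u.1 ≠ z ∧ u.1 ≠ 0 ∧ ‖z‖₊ ≤ 2 * ‖u.1‖₊ then ‖u.1‖₊ ^ (-c) else 0)
    (Measurable.ite hset (by fun_prop) (by fun_prop)) (if_neg fun h => h.1 rfl)).trans ?_
  rcases eq_or_ne u.1 0 with hx0 | hx0
  · simp [hx0]
  have hx : ‖u.1‖₊ ≠ 0 := nnnorm_ne_zero_iff.2 hx0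
  rw [ENNReal.coe_mul]
  gcongr
  calc _ ≤ ∫⁻ z, ((‖u.1‖₊ ^ (-c) : ℝ≥0) : ℝ≥0∞) *
        ((if ‖z - u.1‖₊ ≤ 3 * ‖u.1‖₊ then ‖z - u.1‖₊ ^ (-(l - 2)) else 0 : ℝ≥0) : ℝ≥0∞) ∂μ := by
        refine lintegral_mono fun z => ?_
        rw [← ENNReal.coe_mul, ENNReal.coe_le_coe, neg_sub]
        split_ifs with h h' h'
        · exact le_rfl
        · refine absurd ?_ h'
          have h1 := norm_sub_le z u.1
          have h2 : ‖z‖ ≤ 2 * ‖u.1‖ := h.2.2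
          have : ‖z - u.1‖ ≤ 3 * ‖u.1‖ := by linarith
          exact this
        · simp
        · simp
    _ ≤ ((‖u.1‖₊ ^ (-c) : ℝ≥0) : ℝ≥0∞) *
        (C' * (((3 * ‖u.1‖₊) ^ ((finrank ℝ E : ℝ) - (l - 2)) : ℝ≥0) : ℝ≥0∞)) := by
        rw [lintegral_const_mul' _ _ ENNReal.coe_ne_top, lintegral_sub_right_eq_self
          (fun z => ((if ‖z‖₊ ≤ 3 * ‖u.1‖₊ then ‖z‖₊ ^ (-(l - 2)) else 0 : ℝ≥0) : ℝ≥0∞)) u.1]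
        gcongr
        exact hC' _ (by simpa using hx0)
    _ = _ := by
        rw [← ENNReal.coe_mul, ← ENNReal.coe_mul, NNReal.mul_rpow,
          show (finrank ℝ E : ℝ) - (l - 2) = c by linarith, mul_left_comm, mul_left_comm (_ ^ _),
          ← NNReal.rpow_add hx]
        simp [mul_comm]

end TwistedDistance

section HorizontalWeights

variable {E : Type*} [NormedAddCommGroup E] [NormedSpace ℝ E] [FiniteDimensional ℝ E]
  [MeasurableSpace E] [BorelSpace E] (μ : Measure E) [μ.IsAddHaarMeasure]

open Module (finrank)
open scoped Classical

lemma twistedDist_ne_zero {ω : E → E → ℝ} {u v : E × ℝ} (h : u.1 ≠ v.1) :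
    twistedDist ω u v ≠ 0 := fun h0 => h (by
  have hw := nnnorm_sub_le_twistedDist ω u v
  rw [h0, nonpos_iff_eq_zero, nnnorm_eq_zero, sub_eq_zero] at hw
  exact hw.symm)

lemma bracket_le_three_mul_twistedDist {ω : E → E → ℝ} {u v : E × ℝ} {ρ : ℝ≥0}
    (h : ρ ≤ twistedDist ω u v) :
    ((‖v.1 - u.1‖₊ + ρ) ^ 4 + ‖v.2 + (-u.2 + ω u.1 v.1)‖₊ ^ 2) ^ ((1 : ℝ) / 4)
      ≤ 3 * twistedDist ω u v := by
  have hw := nnnorm_sub_le_twistedDist ω u v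
  have hτ : ‖v.2 + (-u.2 + ω u.1 v.1)‖₊ ^ 2 ≤ twistedDist ω u v ^ 4 := by
    rw [twistedDist, ← NNReal.rpow_natCast _ 4, ← NNReal.rpow_mul]
    norm_num [sub_eq_add_neg, add_assoc]
  generalize twistedDist ω u v = D at *
  rw [one_div, NNReal.rpow_inv_le_iff (by norm_num)]
  norm_cast
  calc _ ≤ (D + D) ^ 4 + D ^ 4 := by gcongr
    _ = 17 * D ^ 4 := by ring
    _ ≤ (3 * D) ^ 4 := by
      rw [mul_pow]; gcongr; norm_num

lemma hlsMajorant_rpow_le {ε Q : ℝ} (hQ : 0 < Q) {ρ D : ℝ≥0} (hρ : ρ ≠ 0) (hD : D ≠ 0) :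
    hlsMajorant ε (ρ ^ (-Q)) (D ^ (-Q)) ≤
      (if ρ ≤ D then ρ ^ (ε * Q) * D ^ (-(Q + ε * Q)) else ρ ^ (-(ε * Q)) * D ^ (-(Q - ε * Q))) := by
  have hiff : D ^ (-Q) ≤ ρ ^ (-Q) ↔ ρ ≤ D :=
    ⟨fun h => by
      by_contra! h'
      rw [NNReal.rpow_neg, NNReal.rpow_neg, inv_le_inv₀ (NNReal.rpow_pos (pos_iff_ne_zero.2 hD))
        (NNReal.rpow_pos (pos_iff_ne_zero.2 hρ)), NNReal.rpow_le_rpow_iff hQ] at h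
      exact absurd h h'.not_ge,
    fun h => by
      rw [NNReal.rpow_neg, NNReal.rpow_neg, inv_le_inv₀ (NNReal.rpow_pos (pos_iff_ne_zero.2 hD))
        (NNReal.rpow_pos (pos_iff_ne_zero.2 hρ)), NNReal.rpow_le_rpow_iff hQ]
      exact h⟩
  unfold hlsMajorant
  simp only [hiff, ← NNReal.rpow_mul]
  split_ifs <;> exact le_of_eq (by ring_nf)

/-- The two-sided cut-off of the critical kernel at height `φ` has integral bounded uniformly in
`φ`. -/
lemma exists_lintegral_hlsMajorant_le (hN : 1 ≤ finrank ℝ E) {ε : ℝ} (hε : 0 < ε)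
    (hεN : ε * (finrank ℝ E + 2) < finrank ℝ E) :
    ∃ C : ℝ≥0, ∀ (ω : E → E → ℝ), Measurable (Function.uncurry ω) → ∀ (u : E × ℝ) (φ : ℝ≥0),
      ∫⁻ v : E × ℝ, ((if u.1 ≠ v.1 then
          hlsMajorant ε φ (twistedDist ω u v ^ (-((finrank ℝ E : ℝ) + 2))) else 0 : ℝ≥0) : ℝ≥0∞)
        ∂(μ.prod volume) ≤ C := by
  set N : ℝ := (finrank ℝ E : ℝ) with hNdef
  have hN0 : 1 ≤ N := by rw [hNdef]; exact_mod_cast hN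
  set e : ℝ := ε * (N + 2) with he
  have he0 : 0 < e := by positivity
  obtain ⟨C₁, hC₁⟩ := exists_lintegral_fibre_le μ (l := N + 2 + e) (by linarith)
  obtain ⟨C₂, hC₂⟩ := exists_lintegral_nnnorm_add_rpow_le μ (s := N + e) (by linarith)
  obtain ⟨C₃, hC₃⟩ := exists_lintegral_twistedDist_le μ (l := N + 2 - e) (by linarith)
  obtain ⟨C₄, hC₄⟩ := exists_lintegral_nnnorm_rpow_le μ hN (b := N - e) (by linarith)
  refine ⟨C₁ * (3 ^ (N + 2 + e) * C₂) + C₃ * C₄, fun ω hω u φ => ?_⟩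
  rcases eq_or_ne φ 0 with rfl | hφ
  · refine le_of_eq_of_le ((lintegral_congr fun v => ?_).trans lintegral_zero) zero_le
    simp only [ENNReal.coe_eq_zero, ite_eq_right_iff]
    intro h
    rw [hlsMajorant, if_neg, NNReal.zero_rpow hε.ne', mul_zero]
    rw [nonpos_iff_eq_zero]
    exact (NNReal.rpow_pos (pos_iff_ne_zero.2 (twistedDist_ne_zero h))).ne'
  obtain ⟨ρ, hρ, rfl⟩ : ∃ ρ : ℝ≥0, ρ ≠ 0 ∧ φ = ρ ^ (-(N + 2)) :=
    ⟨φ ^ (-(N + 2))⁻¹, (NNReal.rpow_pos (pos_iff_ne_zero.2 hφ)).ne', by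
      rw [← NNReal.rpow_mul, inv_mul_cancel₀ (by linarith), NNReal.rpow_one]⟩
  have hm : Measurable fun z => ω u.1 z := hω.comp measurable_prodMk_left
  have hset : MeasurableSet {z : E | u.1 ≠ z ∧ ‖z - u.1‖₊ ≤ ρ} :=
    (measurableSet_eq_fun measurable_const measurable_id).compl.inter
      (measurableSet_le (by fun_prop) measurable_const)
  calc _ ≤ ∫⁻ v : E × ℝ, (((3 ^ (N + 2 + e) * ρ ^ e *
          (((‖v.1 - u.1‖₊ + ρ) ^ 4 + ‖v.2 + (-u.2 + ω u.1 v.1)‖₊ ^ 2) ^ ((1 : ℝ) / 4))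
            ^ (-(N + 2 + e)) : ℝ≥0) : ℝ≥0∞)
        + (((if u.1 ≠ v.1 ∧ ‖v.1 - u.1‖₊ ≤ ρ then ρ ^ (-e) else 0)
          * twistedDist ω u v ^ (-(N + 2 - e)) : ℝ≥0) : ℝ≥0∞)) ∂(μ.prod volume) := by
        refine lintegral_mono fun v => ?_
        rw [← ENNReal.coe_add, ENNReal.coe_le_coe]
        by_cases h : u.1 = v.1
        · simp [h]
        rw [if_pos h]
        have hD := twistedDist_ne_zero (ω := ω) h
        refine (hlsMajorant_rpow_le (by linarith) hρ hD).trans ?_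
        by_cases h1 : ρ ≤ twistedDist ω u v
        · rw [if_pos h1]
          refine le_add_right ?_
          grw [rpow_le_rpow_mul_rpow (s := -(N + 2 + ε * (N + 2))) (by linarith) ?_
            (bracket_le_three_mul_twistedDist h1), neg_neg]
          · rw [mul_left_comm, mul_assoc]
          · positivity
        · rw [if_neg h1, if_pos ⟨h, (nnnorm_sub_le_twistedDist ω u v).trans (not_le.1 h1).le⟩]
          exact le_add_left le_rfl
    _ = ∫⁻ v : E × ℝ, ((3 ^ (N + 2 + e) * ρ ^ e *
          (((‖v.1 - u.1‖₊ + ρ) ^ 4 + ‖v.2 + (-u.2 + ω u.1 v.1)‖₊ ^ 2) ^ ((1 : ℝ) / 4))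
            ^ (-(N + 2 + e)) : ℝ≥0) : ℝ≥0∞) ∂(μ.prod volume)
        + ∫⁻ v : E × ℝ, (((if u.1 ≠ v.1 ∧ ‖v.1 - u.1‖₊ ≤ ρ then ρ ^ (-e) else 0)
          * twistedDist ω u v ^ (-(N + 2 - e)) : ℝ≥0) : ℝ≥0∞) ∂(μ.prod volume) :=
        lintegral_add_left (by fun_prop) _
    _ ≤ _ := by
        rw [ENNReal.coe_add]
        gcongr ?_ + ?_
        · refine (hC₁ (fun z => -u.2 + ω u.1 z) (fun z => ‖z - u.1‖₊ + ρ)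
            (fun _ => 3 ^ (N + 2 + e) * ρ ^ e) (by fun_prop) (by fun_prop) (by fun_prop)
            fun z hz => absurd (add_eq_zero.1 hz).2 hρ).trans ?_
          rw [ENNReal.coe_mul]
          gcongr
          simp_rw [ENNReal.coe_mul _ ((_ : ℝ≥0) ^ (2 - (N + 2 + e)))]
          rw [lintegral_const_mul' _ _ ENNReal.coe_ne_top, lintegral_sub_right_eq_self
            (fun z => (((‖z‖₊ + ρ) ^ (2 - (N + 2 + e)) : ℝ≥0) : ℝ≥0∞)) u.1,
            show 2 - (N + 2 + e) = -(N + e) by ring]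
          grw [hC₂ ρ hρ]
          rw [← ENNReal.coe_mul, ← ENNReal.coe_mul, ENNReal.coe_le_coe, ← hNdef,
            show N - (N + e) = -e by ring, mul_mul_mul_comm, ← NNReal.rpow_add hρ]
          simp
        · refine (hC₃ ω hω u (fun z => if u.1 ≠ z ∧ ‖z - u.1‖₊ ≤ ρ then ρ ^ (-e) else 0)
            (Measurable.ite hset (by fun_prop) (by fun_prop)) (if_neg fun h => h.1 rfl)).trans ?_
          rw [ENNReal.coe_mul]
          gcongr
          calc _ ≤ ∫⁻ z, ((ρ ^ (-e) : ℝ≥0) : ℝ≥0∞) *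
                ((if ‖z - u.1‖₊ ≤ ρ then ‖z - u.1‖₊ ^ (-(N - e)) else 0 : ℝ≥0) : ℝ≥0∞) ∂μ := by
                refine lintegral_mono fun z => ?_
                rw [← ENNReal.coe_mul, ENNReal.coe_le_coe,
                  show 2 - (N + 2 - e) = -(N - e) by ring]
                split_ifs with h h' h'
                · exact le_rfl
                · exact absurd h.2 h'
                · simp
                · simp
            _ ≤ ((ρ ^ (-e) : ℝ≥0) : ℝ≥0∞) * (C₄ * ((ρ ^ (N - (N - e)) : ℝ≥0) : ℝ≥0∞)) := by
                rw [lintegral_const_mul' _ _ ENNReal.coe_ne_top, lintegral_sub_right_eq_self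
                  (fun z => ((if ‖z‖₊ ≤ ρ then ‖z‖₊ ^ (-(N - e)) else 0 : ℝ≥0) : ℝ≥0∞)) u.1]
                gcongr
                exact hC₄ _ hρ
            _ = _ := by
                rw [← ENNReal.coe_mul, ← ENNReal.coe_mul, mul_left_comm, ← NNReal.rpow_add hρ]
                simp

/-- The Stein–Weiss kernel with weights in the first component. -/
def horizontalKernel (α β lam : ℝ) (ω : E → E → ℝ) (u v : E × ℝ) : ℝ≥0 :=
  ‖u.1‖₊ ^ (-α) * ‖v.1‖₊ ^ (-β) * twistedDist ω u v ^ (-lam)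

variable {ω : E → E → ℝ} {A B α β lam : ℝ}

lemma measurable_horizontalKernel (hω : Measurable (Function.uncurry ω)) :
    Measurable fun p : (E × ℝ) × (E × ℝ) => horizontalKernel α β lam ω p.1 p.2 := by
  have := measurable_twistedDist hω
  unfold horizontalKernel
  fun_prop

lemma horizontalKernel_swap (u v : E × ℝ) :
    horizontalKernel α β lam ω u v = horizontalKernel β α lam (fun a b => -ω b a) v u := by
  rw [horizontalKernel, horizontalKernel, twistedDist_swap, mul_comm (‖u.1‖₊ ^ (-α))]

lemma horizontalKernel_eq_rpow_mul_rpow {a₁ b₁ a₂ b₂ l s t : ℝ} {u v : E × ℝ} (hu : u.1 ≠ 0)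
    (hv : v.1 ≠ 0) (ha : α = a₁ * s + a₂ * t) (hb : β = b₁ * s + b₂ * t)
    (hl : lam = l * s + l * t) (hl0 : lam ≠ 0) :
    horizontalKernel α β lam ω u v =
      horizontalKernel a₁ b₁ l ω u v ^ s * horizontalKernel a₂ b₂ l ω u v ^ t := by
  have hu' := nnnorm_ne_zero_iff.2 hu
  have hv' := nnnorm_ne_zero_iff.2 hv
  simp only [horizontalKernel, NNReal.mul_rpow, ← NNReal.rpow_mul]
  rw [show -α = -a₁ * s + -a₂ * t by rw [ha]; ring, show -β = -b₁ * s + -b₂ * t by rw [hb]; ring,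
    show -lam = -l * s + -l * t by rw [hl]; ring, NNReal.rpow_add hu', NNReal.rpow_add hv',
    NNReal.rpow_add' (by contrapose! hl0; rw [hl]; linarith)]
  ring

lemma measurableSet_near :
    MeasurableSet {p : (E × ℝ) × (E × ℝ) | p.2.1 ≠ 0 ∧ 2 * ‖p.2.1‖₊ < ‖p.1.1‖₊} :=
  (measurableSet_eq_fun (f := fun p : (E × ℝ) × (E × ℝ) => p.2.1) (by fun_prop)
    measurable_const).compl.inter (measurableSet_lt (by fun_prop) (by fun_prop))

lemma boundedForm_near (hN : 1 ≤ finrank ℝ E) (hω : Measurable (Function.uncurry ω)) (hA0 : 0 < A)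
    (hA : A < 1) (hB0 : 0 < B) (hB : B < 1) (hAB : 1 ≤ A + B)
    (hα : α < finrank ℝ E * (1 - A)) (hβ : β < finrank ℝ E * (1 - B))
    (hbal : lam + α + β = (2 - A - B) * (finrank ℝ E + 2)) :
    BoundedForm (μ.prod volume) A B fun u v =>
      if v.1 ≠ 0 ∧ 2 * ‖v.1‖₊ < ‖u.1‖₊ then horizontalKernel α β lam ω u v else 0 := by
  set N : ℝ := (finrank ℝ E : ℝ) with hNdef
  have hR : 0 < 2 - A - B := by linarith
  obtain ⟨l, rfl⟩ : ∃ l, lam = l * (2 - A - B) := ⟨lam / (2 - A - B), by field_simp⟩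
  have hl : 2 < l := by
    refine lt_of_mul_lt_mul_right ?_ hR.le
    nlinarith
  obtain ⟨δ, hδ, hδ'⟩ : ∃ δ : ℝ, 0 < δ ∧ β + δ * (1 - A) < N * (1 - B) := by
    refine ⟨(N * (1 - B) - β) / (2 * (1 - A)), div_pos (by linarith) (by linarith), ?_⟩
    have : 1 - A ≠ 0 := by linarith
    field_simp
    linarith
  set b : ℝ := (β + δ * (1 - A)) / (1 - B) with hb
  have hbB : b * (1 - B) = β + δ * (1 - A) := div_mul_cancel₀ _ (by linarith)
  have hbN : b < N := by rwa [hb, div_lt_iff₀ (by linarith)]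
  obtain ⟨C₁, hC₁⟩ := exists_lintegral_near_axis_le μ hN (a := N + 2 - l - b) hl hbN (by ring)
  obtain ⟨C₂, hC₂⟩ := exists_lintegral_far_axis_le μ (a := N + 2 - l + δ) (b := -δ) hl
    (by linarith) (by ring)
  have hω' : Measurable (Function.uncurry fun a b => -ω b a) := (hω.comp measurable_swap).neg
  refine boundedForm_of_schur_young hA.le hB.le hAB hA0 hB0
    (k₁ := fun u v => if v.1 ≠ 0 ∧ 2 * ‖v.1‖₊ < ‖u.1‖₊ then
      horizontalKernel (N + 2 - l - b) b l ω u v else 0)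
    (k₂ := fun u v => if v.1 ≠ 0 ∧ 2 * ‖v.1‖₊ < ‖u.1‖₊ then
      horizontalKernel (N + 2 - l + δ) (-δ) l ω u v else 0)
    (C₁ := C₁) (C₂ := C₂)
    (Measurable.ite measurableSet_near (measurable_horizontalKernel hω) measurable_const)
    (Measurable.ite measurableSet_near (measurable_horizontalKernel hω) measurable_const)
    (fun u v => ?_) (fun u => ?_) (fun v => ?_)
  · split_ifs with h
    · have hu : u.1 ≠ 0 := nnnorm_ne_zero_iff.1 (pos_of_gt h.2).ne'
      refine (horizontalKernel_eq_rpow_mul_rpow hu h.1 ?_ ?_ (by ring) ?_).le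
      · linear_combination hbal + hbB
      · linear_combination -hbB
      · exact (mul_pos (by linarith) hR).ne'
    · exact zero_le
  · refine le_of_eq_of_le (lintegral_congr fun v => ?_) (hC₁ ω hω u)
    rw [ite_zero_mul]
    rfl
  · refine le_of_eq_of_le (lintegral_congr fun u => ?_) (hC₂ _ hω' v)
    rw [ite_zero_mul, ← twistedDist_swap]
    rfl

lemma boundedForm_far (hN : 1 ≤ finrank ℝ E) (hω : Measurable (Function.uncurry ω)) (hA0 : 0 < A)
    (hA : A < 1) (hB0 : 0 < B) (hB : B < 1) (hAB : 1 ≤ A + B)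
    (hα : α < finrank ℝ E * (1 - A)) (hβ : β < finrank ℝ E * (1 - B))
    (hbal : lam + α + β = (2 - A - B) * (finrank ℝ E + 2)) :
    BoundedForm (μ.prod volume) A B fun u v =>
      if u.1 ≠ 0 ∧ 2 * ‖u.1‖₊ < ‖v.1‖₊ then horizontalKernel α β lam ω u v else 0 := by
  have hω' : Measurable (Function.uncurry fun a b => -ω b a) := (hω.comp measurable_swap).neg
  have h := (boundedForm_near μ hN hω' hB0 hB hA0 hA (by linarith) hβ hα (lam := lam)
    (by linarith)).swap (Measurable.ite measurableSet_near (measurable_horizontalKernel hω')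
      measurable_const)
  simpa only [← horizontalKernel_swap] using h

/-- On the region where both variables are comparably far from the vertical axis, weights can be
transferred from one variable to the other. -/
lemma rpow_le_of_comparable {x y : ℝ≥0} (hx : x ≠ 0) (hxy : x ≤ 2 * y)
    (hyx : y ≤ 2 * x) (s : ℝ) : y ^ s ≤ 2 ^ |s| * x ^ s := by
  rcases le_total s 0 with hs | hs
  · rw [abs_of_nonpos hs]
    exact rpow_le_rpow_mul_rpow hs hx hxy
  · rw [abs_of_nonneg hs, ← NNReal.mul_rpow]
    exact NNReal.rpow_le_rpow hyx hs

lemma boundedForm_diagonal (hN : 1 ≤ finrank ℝ E) (hω : Measurable (Function.uncurry ω))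
    (hA0 : 0 < A)
    (hA : A < 1) (hB0 : 0 < B) (hB : B < 1) (hAB : 1 ≤ A + B)
    (hαβ : 0 < α + β)
    (hα : α < finrank ℝ E * (1 - A)) (hβ : β < finrank ℝ E * (1 - B))
    (hbal : lam + α + β = (2 - A - B) * (finrank ℝ E + 2)) :
    BoundedForm (μ.prod volume) A B fun u v =>
      if u.1 ≠ v.1 ∧ u.1 ≠ 0 ∧ v.1 ≠ 0 ∧ ‖u.1‖₊ ≤ 2 * ‖v.1‖₊ ∧ ‖v.1‖₊ ≤ 2 * ‖u.1‖₊ then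
        horizontalKernel α β lam ω u v else 0 := by
  set N : ℝ := (finrank ℝ E : ℝ) with hNdef
  have hR : 0 < 2 - A - B := by linarith
  obtain ⟨l, rfl⟩ : ∃ l, lam = l * (2 - A - B) := ⟨lam / (2 - A - B), by field_simp⟩
  have hl : 2 < l := by
    refine lt_of_mul_lt_mul_right ?_ hR.le
    nlinarith
  have hlN : l < N + 2 := by
    refine lt_of_mul_lt_mul_right ?_ hR.le
    linarith
  obtain ⟨C, hC⟩ := exists_lintegral_diagonal_le μ hN (c := N + 2 - l) hl hlN (by ring)
  have hω' : Measurable (Function.uncurry fun a b => -ω b a) := (hω.comp measurable_swap).neg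
  have hs1 : MeasurableSet {p : (E × ℝ) × (E × ℝ) |
      p.1.1 ≠ p.2.1 ∧ p.1.1 ≠ 0 ∧ ‖p.2.1‖₊ ≤ 2 * ‖p.1.1‖₊} :=
    (measurableSet_eq_fun (f := fun p : (E × ℝ) × (E × ℝ) => p.1.1) (g := fun p => p.2.1)
      (by fun_prop) (by fun_prop)).compl.inter
      ((measurableSet_eq_fun (f := fun p : (E × ℝ) × (E × ℝ) => p.1.1) (by fun_prop)
        measurable_const).compl.inter (measurableSet_le (by fun_prop) (by fun_prop)))
  have hm1 : ∀ {ω : E → E → ℝ}, Measurable (Function.uncurry ω) →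
      Measurable fun p : (E × ℝ) × (E × ℝ) =>
      if p.1.1 ≠ p.2.1 ∧ p.1.1 ≠ 0 ∧ ‖p.2.1‖₊ ≤ 2 * ‖p.1.1‖₊ then
        horizontalKernel (N + 2 - l) 0 l ω p.1 p.2 else 0 := fun hω =>
    Measurable.ite hs1 (measurable_horizontalKernel hω) measurable_const
  have key := boundedForm_of_schur_young (ν := μ.prod volume) hA.le hB.le hAB hA0 hB0
    (k₁ := fun u v => if u.1 ≠ v.1 ∧ u.1 ≠ 0 ∧ ‖v.1‖₊ ≤ 2 * ‖u.1‖₊ then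
      horizontalKernel (N + 2 - l) 0 l ω u v else 0)
    (k₂ := fun u v => if v.1 ≠ u.1 ∧ v.1 ≠ 0 ∧ ‖u.1‖₊ ≤ 2 * ‖v.1‖₊ then
      horizontalKernel (N + 2 - l) 0 l (fun a b => -ω b a) v u else 0)
    (C₁ := C) (C₂ := C) (hm1 hω) ((hm1 hω').comp measurable_swap) (fun u v => le_rfl)
    (fun u => le_of_eq_of_le (lintegral_congr fun v => by
      rw [ite_zero_mul]; simp [horizontalKernel]) (hC ω hω u))
    (fun v => le_of_eq_of_le (lintegral_congr fun u => by
      rw [ite_zero_mul]; simp [horizontalKernel]) (hC _ hω' v))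
  refine key.mono (2 ^ |-β + (N + 2 - l) * (1 - A)|) fun u v => ?_
  split_ifs with h h1 h2 h2
  · obtain ⟨-, hu, hv, huv, hvu⟩ := h
    have hu' := nnnorm_ne_zero_iff.2 hu
    have hv' := nnnorm_ne_zero_iff.2 hv
    rw [← horizontalKernel_swap, ← horizontalKernel_eq_rpow_mul_rpow
      (α := α + β - (N + 2 - l) * (1 - A)) (β := (N + 2 - l) * (1 - A)) hu hv
      (lam := l * (2 - A - B)) (by linear_combination hbal) (by ring) (by ring)
      (mul_pos (by linarith) hR).ne']
    have hc := rpow_le_of_comparable hu' huv hvu (-β + (N + 2 - l) * (1 - A))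
    simp only [horizontalKernel]
    calc _ = ‖u.1‖₊ ^ (-α) * (‖v.1‖₊ ^ (-β + (N + 2 - l) * (1 - A))
            * ‖v.1‖₊ ^ (-((N + 2 - l) * (1 - A)))) * twistedDist ω u v ^ (-(l * (2 - A - B))) := by
          rw [← NNReal.rpow_add hv']; ring_nf
      _ ≤ ‖u.1‖₊ ^ (-α) * ((2 ^ |-β + (N + 2 - l) * (1 - A)|
            * ‖u.1‖₊ ^ (-β + (N + 2 - l) * (1 - A)))
            * ‖v.1‖₊ ^ (-((N + 2 - l) * (1 - A)))) * twistedDist ω u v ^ (-(l * (2 - A - B))) := by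
          gcongr
      _ = _ := by
          rw [show -(α + β - (N + 2 - l) * (1 - A)) = -α + (-β + (N + 2 - l) * (1 - A)) by ring,
            NNReal.rpow_add hu' (-α)]
          ac_rfl
  · exact absurd ⟨Ne.symm h.1, h.2.2.1, h.2.2.2.1⟩ h2
  · exact absurd ⟨h.1, h.2.1, h.2.2.2.2⟩ h1
  · exact absurd ⟨h.1, h.2.1, h.2.2.2.2⟩ h1
  all_goals exact zero_le

/-- The Hardy–Littlewood–Sobolev inequality. -/
lemma boundedForm_twistedDist (hN : 1 ≤ finrank ℝ E) (hω : Measurable (Function.uncurry ω))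
    (hA0 : 0 < A) (hA : A < 1) (hB0 : 0 < B) (hB : B < 1) (hAB : 1 < A + B) :
    BoundedForm (μ.prod volume) A B fun u v =>
      if u.1 ≠ v.1 then twistedDist ω u v ^ (-((2 - A - B) * (finrank ℝ E + 2))) else 0 := by
  set N : ℝ := (finrank ℝ E : ℝ) with hNdef
  have hN1 : (1 : ℝ) ≤ N := by rw [hNdef]; exact_mod_cast hN
  obtain ⟨ε, hε, hε'⟩ := exists_between (show (0 : ℝ) <
    min (min (1 - A) (1 - B)) (min (A + B - 1) (N / (N + 2))) by
      have : 0 < N / (N + 2) := by positivity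
      simp only [lt_min_iff]
      refine ⟨⟨?_, ?_⟩, ?_, this⟩ <;> linarith)
  simp only [lt_min_iff] at hε'
  obtain ⟨⟨hεA, hεB⟩, hεAB, hεN⟩ := hε'
  rw [lt_div_iff₀ (by positivity)] at hεN
  obtain ⟨C, hC⟩ := exists_lintegral_hlsMajorant_le μ hN hε hεN
  have hω' : Measurable (Function.uncurry fun a b => -ω b a) := (hω.comp measurable_swap).neg
  have hs : MeasurableSet {p : (E × ℝ) × (E × ℝ) | p.1.1 ≠ p.2.1} :=
    (measurableSet_eq_fun (f := fun p : (E × ℝ) × (E × ℝ) => p.1.1) (g := fun p => p.2.1)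
      (by fun_prop) (by fun_prop)).compl
  have hm : ∀ {ω : E → E → ℝ} {F : E × ℝ → ℝ≥0}, Measurable (Function.uncurry ω) → Measurable F →
      Measurable fun p : (E × ℝ) × (E × ℝ) => if p.1.1 ≠ p.2.1 then
        hlsMajorant ε (F p.1) (twistedDist ω p.1 p.2 ^ (-(N + 2))) else 0 := by
    intro ω F hω hF
    have hD := (measurable_twistedDist hω).pow_const (-(N + 2))
    have hF' : Measurable fun p : (E × ℝ) × (E × ℝ) => F p.1 := hF.comp measurable_fst
    refine Measurable.ite hs (Measurable.ite (measurableSet_le hD hF') ?_ ?_) measurable_const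
    · exact (hD.pow_const _).mul (hF'.pow_const _)
    · exact (hD.pow_const _).mul (hF'.pow_const _)
  refine boundedForm_of_majorants C C fun F G hF hG =>
    ⟨fun u v => if u.1 ≠ v.1 then hlsMajorant ε (F u) (twistedDist ω u v ^ (-(N + 2))) else 0,
      fun u v => if v.1 ≠ u.1 then
        hlsMajorant ε (G v) (twistedDist (fun a b => -ω b a) v u ^ (-(N + 2))) else 0,
      hm hω hF, (hm hω' hG).comp measurable_swap, fun u v => ?_, fun u => hC ω hω u (F u),
      fun v => hC _ hω' v (G v)⟩
  by_cases h : u.1 = v.1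
  · simp [h]
  beta_reduce
  rw [if_pos h, if_pos h, if_pos (Ne.symm h), ← twistedDist_swap]
  refine le_of_eq_of_le ?_ (rpow_mul_rpow_mul_rpow_le hA0 hB0 (ε := ε) (by linarith) (by linarith)
    hε.le (by linarith) (F u) (G v) (twistedDist ω u v ^ (-(N + 2)))
    (NNReal.rpow_pos (pos_iff_ne_zero.2 (twistedDist_ne_zero h))).ne')
  rw [← NNReal.rpow_mul]
  ring_nf

lemma boundedForm_diagonal_of_eq_neg (hN : 1 ≤ finrank ℝ E) (hω : Measurable (Function.uncurry ω))
    (hA0 : 0 < A) (hA : A < 1) (hB0 : 0 < B) (hB : B < 1) (hAB : 1 < A + B) (hαβ : α + β = 0)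
    (hbal : lam + α + β = (2 - A - B) * (finrank ℝ E + 2)) :
    BoundedForm (μ.prod volume) A B fun u v =>
      if u.1 ≠ v.1 ∧ u.1 ≠ 0 ∧ v.1 ≠ 0 ∧ ‖u.1‖₊ ≤ 2 * ‖v.1‖₊ ∧ ‖v.1‖₊ ≤ 2 * ‖u.1‖₊ then
        horizontalKernel α β lam ω u v else 0 := by
  refine (boundedForm_twistedDist μ hN hω hA0 hA hB0 hB hAB).mono (2 ^ |-β|) fun u v => ?_
  split_ifs with h h1
  · obtain ⟨-, hu, hv, huv, hvu⟩ := h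
    have hu' := nnnorm_ne_zero_iff.2 hu
    rw [horizontalKernel, ← hbal, add_assoc, hαβ, add_zero]
    gcongr
    grw [rpow_le_of_comparable hu' huv hvu (-β), mul_left_comm, ← NNReal.rpow_add hu',
      show -α + -β = 0 by linarith, NNReal.rpow_zero, mul_one]
  · exact absurd h.1 h1
  all_goals exact zero_le

/-- The Stein–Weiss inequality with weights in the first component. -/
theorem boundedForm_horizontalKernel (hN : 1 ≤ finrank ℝ E) (hω : Measurable (Function.uncurry ω))
    (hA0 : 0 < A) (hA : A < 1) (hB0 : 0 < B) (hB : B < 1) (hAB : 1 ≤ A + B)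
    (hαβ : 0 ≤ α + β) (hlam : lam < finrank ℝ E + 2)
    (hα : α < finrank ℝ E * (1 - A)) (hβ : β < finrank ℝ E * (1 - B))
    (hbal : lam + α + β = (2 - A - B) * (finrank ℝ E + 2)) :
    BoundedForm (μ.prod volume) A B fun u v =>
      if u.1 ≠ v.1 ∧ u.1 ≠ 0 ∧ v.1 ≠ 0 then horizontalKernel α β lam ω u v else 0 := by
  have hdiag : BoundedForm (μ.prod volume) A B fun u v =>
      if u.1 ≠ v.1 ∧ u.1 ≠ 0 ∧ v.1 ≠ 0 ∧ ‖u.1‖₊ ≤ 2 * ‖v.1‖₊ ∧ ‖v.1‖₊ ≤ 2 * ‖u.1‖₊ then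
        horizontalKernel α β lam ω u v else 0 := by
    rcases hαβ.eq_or_lt with h | h
    · refine boundedForm_diagonal_of_eq_neg μ hN hω hA0 hA hB0 hB ?_ h.symm hbal
      rw [add_assoc, ← h, add_zero] at hbal
      have : 2 - A - B < 1 := by
        refine lt_of_mul_lt_mul_right (a := (finrank ℝ E : ℝ) + 2) ?_ (by positivity)
        linarith
      linarith
    · exact boundedForm_diagonal μ hN hω hA0 hA hB0 hB hAB h hα hβ hbal
  have hsf : MeasurableSet {p : (E × ℝ) × (E × ℝ) | p.1.1 ≠ 0 ∧ 2 * ‖p.1.1‖₊ < ‖p.2.1‖₊} :=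
    measurable_swap measurableSet_near
  have hmk := measurable_horizontalKernel (α := α) (β := β) (lam := lam) hω
  refine (((boundedForm_near μ hN hω hA0 hA hB0 hB hAB hα hβ hbal).add
    (boundedForm_far μ hN hω hA0 hA hB0 hB hAB hα hβ hbal)
    (Measurable.ite measurableSet_near hmk measurable_const)).add hdiag
    ((Measurable.ite measurableSet_near hmk measurable_const).add
      (Measurable.ite hsf hmk measurable_const))).mono 1 fun u v => ?_
  rw [one_mul]
  split_ifs with h h1 h2 h3 h3 h2 h3 h3
  all_goals first
    | exact zero_le
    | exact le_add_left le_rfl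
    | exact le_add_right (le_add_left le_rfl)
    | exact le_add_right (le_add_right le_rfl)
    | exfalso; grind

end HorizontalWeights

section Normalization

variable {X : Type*} [MeasurableSpace X] {ν : Measure X}

lemma MeasureTheory.MemLp.exists_normalization {f : X → ℝ} {p : ℝ} (hp : 0 < p)
    (hf : MemLp f (ENNReal.ofReal p) ν) :
    ∃ F : X → ℝ≥0, Measurable F ∧ ∫⁻ x, F x ∂ν ≤ 1 ∧
      ∀ᵐ x ∂ν, ‖f x‖₊ = (eLpNorm f (ENNReal.ofReal p) ν).toNNReal * F x ^ (1 / p) := by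
  obtain ⟨f', hf', hff'⟩ := hf.1
  set M : ℝ≥0 := (eLpNorm f (ENNReal.ofReal p) ν).toNNReal with hM
  have hMe : (M : ℝ≥0∞) = eLpNorm f (ENNReal.ofReal p) ν := ENNReal.coe_toNNReal hf.2.ne
  have hp0 : ENNReal.ofReal p ≠ 0 := by simpa using hp
  refine ⟨fun x => ‖(M : ℝ)⁻¹ • f' x‖₊ ^ p, by have := hf'.measurable; fun_prop, ?_, ?_⟩
  · have h := eLpNorm_const_smul (M : ℝ)⁻¹ f' (ENNReal.ofReal p) ν
    rw [← eLpNorm_congr_ae hff', ← hMe,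
      eLpNorm_eq_lintegral_rpow_enorm_toReal hp0 ENNReal.ofReal_ne_top,
      ENNReal.toReal_ofReal hp.le] at h
    have h1 : (∫⁻ x, ‖((M : ℝ)⁻¹ • f') x‖ₑ ^ p ∂ν) ^ (1 / p) ≤ 1 := by
      rw [h, enorm_eq_nnnorm, ← ENNReal.coe_mul, ← ENNReal.coe_one, ENNReal.coe_le_coe, nnnorm_inv,
        NNReal.nnnorm_eq]
      exact inv_mul_le_one
    rw [one_div, ENNReal.rpow_inv_le_iff hp, ENNReal.one_rpow] at h1
    refine le_of_eq_of_le (lintegral_congr fun x => ?_) h1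
    rw [ENNReal.coe_rpow_of_nonneg _ hp.le]
    rfl
  · by_cases hM0 : M = 0
    · rw [hM0, ENNReal.coe_zero, eq_comm, eLpNorm_eq_zero_iff hf.1 hp0] at hMe
      filter_upwards [hMe] with x hx
      simp [hx, hM0]
    · filter_upwards [hff'] with x hx
      rw [← NNReal.rpow_mul, mul_one_div_cancel hp.ne', NNReal.rpow_one, nnnorm_smul, nnnorm_inv,
        NNReal.nnnorm_eq, mul_inv_cancel_left₀ hM0, hx]

lemma BoundedForm.exists_lintegral_le {p q : ℝ} {k : X → X → ℝ≥0}
    (h : BoundedForm ν (1 / p) (1 / q) k) (hp : 0 < p) (hq : 0 < q) :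
    ∃ C : ℝ≥0, ∀ f g : X → ℝ,
      MemLp f (ENNReal.ofReal p) ν → MemLp g (ENNReal.ofReal q) ν →
      ∫⁻ u, ∫⁻ v, ((‖f u‖₊ * ‖g v‖₊ * k u v : ℝ≥0) : ℝ≥0∞) ∂ν ∂ν ≤
        C * eLpNorm f (ENNReal.ofReal p) ν * eLpNorm g (ENNReal.ofReal q) ν := by
  obtain ⟨C, hC⟩ := h
  refine ⟨C, fun f g hf hg => ?_⟩
  obtain ⟨F, hF, hF1, hfF⟩ := hf.exists_normalization hp
  obtain ⟨G, hG, hG1, hgG⟩ := hg.exists_normalization hq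
  rw [← ENNReal.coe_toNNReal hf.2.ne, ← ENNReal.coe_toNNReal hg.2.ne]
  generalize (eLpNorm f (ENNReal.ofReal p) ν).toNNReal = a at *
  generalize (eLpNorm g (ENNReal.ofReal q) ν).toNNReal = b at *
  calc _ = ∫⁻ u, ∫⁻ v, ((a * b : ℝ≥0) : ℝ≥0∞) *
          ((F u ^ (1 / p) * G v ^ (1 / q) * k u v : ℝ≥0) : ℝ≥0∞) ∂ν ∂ν := by
        refine lintegral_congr_ae ?_
        filter_upwards [hfF] with u hu
        refine lintegral_congr_ae ?_
        filter_upwards [hgG] with v hv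
        rw [hu, hv, ← ENNReal.coe_mul, ENNReal.coe_inj]
        ring
    _ ≤ ((a * b : ℝ≥0) : ℝ≥0∞) * C := by
        simp_rw [lintegral_const_mul' _ _ ENNReal.coe_ne_top]
        gcongr
        exact hC F G hF hG hF1 hG1
    _ = _ := by
        rw [ENNReal.coe_mul]
        ring

end Normalization

section Comparison

variable {n : ℕ}

lemma norm_le_znorm (z : Fin n → ℂ) : ‖z‖ ≤ znorm z := by
  refine (pi_norm_le_iff_of_nonneg (Real.sqrt_nonneg _)).2 fun j => ?_
  rw [Complex.norm_def]
  exact Real.sqrt_le_sqrt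
    (Finset.single_le_sum (fun i _ => Complex.normSq_nonneg (z i)) (Finset.mem_univ j))

lemma znorm_le_sqrt_mul_norm (z : Fin n → ℂ) : znorm z ≤ √n * ‖z‖ := by
  rw [znorm, Real.sqrt_le_left (by positivity), mul_pow, Real.sq_sqrt (by positivity)]
  calc _ ≤ ∑ _j : Fin n, ‖z‖ ^ 2 := by
        gcongr with j
        rw [Complex.normSq_eq_norm_sq]
        gcongr
        exact norm_le_pi_norm z j
    _ = _ := by simp

lemma znorm_rpow_neg_le (hn : 1 ≤ n) {z : Fin n → ℂ} (hz : z ≠ 0) (α : ℝ) :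
    (znorm z ^ α)⁻¹ ≤ √n ^ |α| * ‖z‖ ^ (-α) := by
  have hz' : 0 < ‖z‖ := norm_pos_iff.2 hz
  have hn' : 1 ≤ √n := Real.one_le_sqrt.2 (by exact_mod_cast hn)
  have h1 := norm_le_znorm z
  have h2 := znorm_le_sqrt_mul_norm z
  rw [← Real.rpow_neg (hz'.le.trans h1)]
  rcases le_total α 0 with h | h
  · rw [abs_of_nonpos h, ← Real.mul_rpow (by positivity) (by positivity)]
    exact Real.rpow_le_rpow (hz'.le.trans h1) h2 (by linarith)
  · calc _ ≤ ‖z‖ ^ (-α) := Real.rpow_le_rpow_of_nonpos hz' h1 (by linarith)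
      _ ≤ _ := le_mul_of_one_le_left (by positivity) (Real.one_le_rpow hn' (abs_nonneg _))

/-- The symplectic form entering the group law. -/
def twist (z w : Fin n → ℂ) : ℝ := 2 * (∑ j, (-z) j * (starRingEnd ℂ) (w j)).im

lemma measurable_twist : Measurable (Function.uncurry (twist (n := n))) := by
  unfold Function.uncurry twist
  apply Continuous.measurable
  fun_prop

lemma twistedDist_le_Hdist (u v : Hn n) : (twistedDist twist u v : ℝ) ≤ Hdist u v := by
  have h := norm_le_znorm (v.1 - u.1)
  have e : Hdist u v =
      (znorm (v.1 - u.1) ^ 4 + (v.2 - u.2 + twist u.1 v.1) ^ 2) ^ ((1 : ℝ) / 4) := by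
    simp only [Hdist, Hnorm, Hmul, Hinv, twist, sub_eq_neg_add]
  rw [e, twistedDist]
  push_cast
  rw [Real.norm_eq_abs, sq_abs]
  gcongr

lemma kernel_le_horizontalKernel (hn : 1 ≤ n) {α β lam : ℝ} (hlam : 0 ≤ lam) {u v : Hn n}
    (huv : u.1 ≠ v.1) (hu : u.1 ≠ 0) (hv : v.1 ≠ 0) :
    (znorm u.1 ^ α * Hdist u v ^ lam * znorm v.1 ^ β)⁻¹ ≤
      √n ^ (|α| + |β|) * horizontalKernel α β lam twist u v := by
  have hD : (0 : ℝ) < twistedDist twist u v :=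
    NNReal.coe_pos.2 (pos_iff_ne_zero.2 (twistedDist_ne_zero huv))
  have hDH := twistedDist_le_Hdist u v
  have hn' : (0 : ℝ) < √n := Real.sqrt_pos.2 (by exact_mod_cast hn)
  have hz : 0 ≤ znorm v.1 := Real.sqrt_nonneg _
  have hH : 0 ≤ Hdist u v := hD.le.trans hDH
  rw [mul_inv, mul_inv, horizontalKernel, Real.rpow_add hn', ← Real.rpow_neg hH]
  push_cast
  calc _ ≤ (√n ^ |α| * ‖u.1‖ ^ (-α)) * (twistedDist twist u v : ℝ) ^ (-lam)
        * (√n ^ |β| * ‖v.1‖ ^ (-β)) := by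
        gcongr ?_ * ?_ * ?_
        · exact znorm_rpow_neg_le hn hu α
        · exact Real.rpow_le_rpow_of_nonpos hD hDH (by linarith)
        · exact znorm_rpow_neg_le hn hv β
    _ = _ := by ring

lemma ae_fst_ne (hn : 1 ≤ n) (c : Fin n → ℂ) : ∀ᵐ v : Hn n, v.1 ≠ c := by
  have : Nonempty (Fin n) := ⟨⟨0, hn⟩⟩
  have h : ∀ᵐ z : Fin n → ℂ, z ≠ c := compl_mem_ae_iff.2 (measure_singleton c)
  exact Measure.quasiMeasurePreserving_fst.ae h

end Comparison

/-- **Stein–Weiss inequality with horizontal (`|z|`) weights on the Heisenberg group**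
(Theorem E). -/
theorem stein_weiss_heisenberg_horizontal_weights
    (n : ℕ) (hn : 1 ≤ n) (Q p p' q q' lam α β : ℝ) (hQ : Q = 2 * n + 2)
    (hp : 1 < p) (hq' : 1 < q')
    (hq : 1 / q + 1 / q' = 1) (hp' : 1 / p + 1 / p' = 1)
    (hlam0 : 0 < lam) (hlamQ : lam < Q)
    (hab : 0 ≤ α + β) (habQ : lam + α + β ≤ Q)
    (hβ : β < 2 * n / p') (hα : α < 2 * n / q)
    (hbal : 1 / p + 1 / q' + (lam + α + β) / Q = 2) :
    ∃ C : ℝ, 0 < C ∧ ∀ f g : Hn n → ℝ,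
      MemLp f (ENNReal.ofReal q') volume → MemLp g (ENNReal.ofReal p) volume →
      ∫⁻ u, ∫⁻ v, ENNReal.ofReal
          (|f u| * |g v| / (znorm u.1 ^ α * Hdist u v ^ lam * znorm v.1 ^ β)) ≤
        ENNReal.ofReal C * eLpNorm f (ENNReal.ofReal q') volume *
          eLpNorm g (ENNReal.ofReal p) volume := by
  have hfr : Module.finrank ℝ (Fin n → ℂ) = 2 * n := by
    simp [Module.finrank_pi_fintype, mul_comm]
  have hfr' : ((Module.finrank ℝ (Fin n → ℂ) : ℕ) : ℝ) = 2 * n := by rw [hfr]; push_cast; rfl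
  have hQ0 : 0 < Q := by rw [hQ]; positivity
  have hdiv : (lam + α + β) / Q ≤ 1 := (div_le_one hQ0).2 habQ
  obtain ⟨k, hk, key⟩ : ∃ k : Hn n → Hn n → ℝ≥0,
      (∀ u v, u.1 ≠ v.1 ∧ u.1 ≠ 0 ∧ v.1 ≠ 0 → k u v = horizontalKernel α β lam twist u v) ∧
      BoundedForm volume (1 / q') (1 / p) k := ⟨_, fun u v h => if_pos h,
    boundedForm_horizontalKernel (volume : Measure (Fin n → ℂ)) (by omega) measurable_twist (by positivity)
    ((div_lt_one (by linarith)).2 hq') (by positivity) ((div_lt_one (by linarith)).2 hp)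
    (by linarith) hab (by rwa [hfr', ← hQ])
    (by rwa [hfr', ← eq_sub_of_add_eq hq, mul_one_div])
    (by rwa [hfr', ← eq_sub_of_add_eq' hp', mul_one_div])
    (by
      rw [hfr', ← hQ, ← hbal]
      field_simp
      ring)⟩
  obtain ⟨C, hC⟩ := key.exists_lintegral_le (by linarith) (by linarith)
  have hn' : (0 : ℝ) < √n := Real.sqrt_pos.2 (by exact_mod_cast hn)
  refine ⟨√n ^ (|α| + |β|) * (C + 1), by positivity, fun f g hf hg => ?_⟩
  obtain ⟨K, hK⟩ : ∃ K : ℝ≥0, (K : ℝ) = √n ^ (|α| + |β|) := ⟨⟨_, by positivity⟩, rfl⟩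
  have hCK : ENNReal.ofReal (√n ^ (|α| + |β|) * (C + 1)) = K * ((C + 1 : ℝ≥0) : ℝ≥0∞) := by
    rw [← hK, ← ENNReal.coe_mul, ← ENNReal.ofReal_coe_nnreal]
    push_cast
    rfl
  rw [hCK]
  calc _ ≤ ∫⁻ u, ∫⁻ v, (K : ℝ≥0∞) * ((‖f u‖₊ * ‖g v‖₊ * k u v : ℝ≥0) : ℝ≥0∞) := by
        refine lintegral_mono_ae ?_
        filter_upwards [ae_fst_ne hn 0] with u hu
        refine lintegral_mono_ae ?_
        filter_upwards [ae_fst_ne hn 0, ae_fst_ne hn u.1] with v hv huv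
        rw [hk u v ⟨huv.symm, hu, hv⟩, ← ENNReal.coe_mul, ← ENNReal.ofReal_coe_nnreal]
        refine ENNReal.ofReal_le_ofReal ?_
        push_cast
        rw [hK, mul_left_comm, div_eq_mul_inv, Real.norm_eq_abs, Real.norm_eq_abs]
        gcongr
        exact kernel_le_horizontalKernel hn hlam0.le huv.symm hu hv
    _ ≤ K * (C * eLpNorm f (ENNReal.ofReal q') volume * eLpNorm g (ENNReal.ofReal p) volume) := by
        simp_rw [lintegral_const_mul' _ _ ENNReal.coe_ne_top]
        gcongr
        exact hC f g hf hg
    _ ≤ _ := by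
        rw [← mul_assoc, ← mul_assoc]
        gcongr
        exact le_self_add
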